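/- Uniqueness of ConceptSHAP (Shapley uniqueness theorem): Let C be a finite set of m ≥ 1 concepts. Suppose ψ assigns to every completeness score η on C with η(∅) = 0 and every i ∈ C a real number ψ_i(η) such that: (Efficiency) ∑_{i ∈ C} ψ_i(η) = η(C); (Symmetry) if η(S ∪ {i}) = η(S ∪ {j}) for every S ⊆ C \ {i, j} then ψ_i(η) = ψ_j(η); (Dummy) if η(S ∪ {i}) = η(S) for every S ⊆ C \ {i} then ψ_i(η) = 0; (Additivity) ψ_i(a₁η + a₂η') = a₁ψ_i(η) + a₂ψ_i(η') for all scalars a₁, a₂ ∈ ℝ and all such games η, η'. Then ψ_i(η) = s_i(η) for every completeness score η with η(∅) = 0 and every i ∈ C. -/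

import Mathlib

/-- The ConceptSHAP value of concept `i` for a completeness score (cooperative game)
`η` on the finite set of concepts `ι`:
`s_i(η) = ∑_{S ⊆ C \ {i}} ((m − |S| − 1)! · |S|! / m!) · (η(S ∪ {i}) − η(S))`. -/
noncomputable def conceptSHAP {ι : Type*} [Fintype ι] [DecidableEq ι]
    (η : Finset ι → ℝ) (i : ι) : ℝ :=
  ∑ S ∈ (Finset.univ.erase i).powerset,
    (((Nat.factorial (Fintype.card ι - S.card - 1) * Nat.factorial S.card : ℕ) : ℝ) /
      ((Nat.factorial (Fintype.card ι) : ℕ) : ℝ)) * (η (insert i S) - η S)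

lemma shap_sum_insert {ι : Type*} [Fintype ι] [DecidableEq ι] (f : Finset ι → ℝ) (i : ι) :
    ∑ S ∈ (Finset.univ.erase i).powerset, f (insert i S) =
      ∑ T : Finset ι, if i ∈ T then f T else 0 := by
  rw [← Finset.sum_filter]
  refine Finset.sum_nbij' (fun S => insert i S) (fun T => T.erase i) ?_ ?_ ?_ ?_ ?_
  · intro S hS
    simp
  · intro T hT
    simp only [Finset.mem_powerset]
    exact Finset.erase_subset_erase _ (Finset.subset_univ _)
  · intro S hS
    have : i ∉ S := fun h => by simpa using Finset.mem_powerset.1 hS h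
    exact Finset.erase_insert this
  · intro T hT
    exact Finset.insert_erase (by simpa using hT)
  · intro S hS
    rfl

lemma shap_sum_base {ι : Type*} [Fintype ι] [DecidableEq ι] (f : Finset ι → ℝ) (i : ι) :
    ∑ S ∈ (Finset.univ.erase i).powerset, f S =
      ∑ T : Finset ι, if i ∈ T then 0 else f T := by
  have : (Finset.univ.erase i).powerset = Finset.univ.filter (fun T : Finset ι => i ∉ T) := by
    ext T
    simp [Finset.subset_erase]
  rw [this, Finset.sum_filter]
  refine Finset.sum_congr rfl fun T _ => ?_
  by_cases h : i ∈ T <;> simp [h]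

lemma shap_eff {ι : Type*} [Fintype ι] [DecidableEq ι] [Nonempty ι]
    (η : Finset ι → ℝ) (h0 : η ∅ = 0) : ∑ i, conceptSHAP η i = η Finset.univ := by
  let m := Fintype.card ι
  let w : ℕ → ℝ := fun k =>
    ((Nat.factorial (m - k - 1) * Nat.factorial k : ℕ) : ℝ) / ((Nat.factorial m : ℕ) : ℝ)
  have key : ∀ i, conceptSHAP η i = ∑ T : Finset ι,
      ((if i ∈ T then w (T.card - 1) * η T else 0) - (if i ∈ T then 0 else w T.card * η T)) := by
    intro i
    rw [Finset.sum_sub_distrib, ← shap_sum_insert (fun T => w (T.card - 1) * η T),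
      ← shap_sum_base (fun T => w T.card * η T), ← Finset.sum_sub_distrib]
    refine Finset.sum_congr rfl fun S hS => ?_
    have : i ∉ S := fun h => by simpa using Finset.mem_powerset.1 hS h
    simp only [Finset.card_insert_of_notMem this, Nat.add_sub_cancel]
    rw [← mul_sub]
  simp_rw [key]
  rw [Finset.sum_comm]
  have hm : 0 < m := Fintype.card_pos
  have hf : ((Nat.factorial m : ℕ) : ℝ) ≠ 0 := by exact_mod_cast Nat.factorial_ne_zero m
  have inner : ∀ T : Finset ι, ∑ i, ((if i ∈ T then w (T.card - 1) * η T else 0) -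
      (if i ∈ T then 0 else w T.card * η T)) =
      (T.card * w (T.card - 1) - ((m - T.card : ℕ) : ℝ) * w T.card) * η T := by
    intro T
    have e : ∀ i, (if i ∈ T then 0 else w T.card * η T) =
      if i ∈ Tᶜ then w T.card * η T else 0 := by
      intro i
      by_cases h : i ∈ T <;> simp [h]
    simp_rw [e]
    rw [Finset.sum_sub_distrib, Finset.sum_ite_mem, Finset.sum_ite_mem]
    simp only [Finset.univ_inter, Finset.sum_const, nsmul_eq_mul, Finset.card_compl]
    ring
  simp_rw [inner]
  rw [Finset.sum_eq_single Finset.univ]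
  · have : (Finset.univ : Finset ι).card = m := rfl
    rw [this]
    obtain ⟨n, hn⟩ : ∃ n, m = n + 1 := ⟨m - 1, by omega⟩
    have hf' := hf
    simp only [w, hn] at hf' ⊢
    have e : n + 1 - (n + 1 - 1) - 1 = 0 := by omega
    rw [e]
    rw [Nat.factorial_succ] at hf' ⊢
    simp only [Nat.add_sub_cancel, Nat.sub_self, Nat.factorial_zero, one_mul, Nat.cast_zero,
      zero_mul, sub_zero]
    rw [← mul_div_assoc, ← Nat.cast_mul, div_self hf', one_mul]
  · intro T _ hT
    rcases T.eq_empty_or_nonempty with rfl | hne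
    · simp [h0]
    have hlt : T.card < m := (Finset.card_lt_iff_ne_univ T).2 hT
    have hpos : 0 < T.card := hne.card_pos
    obtain ⟨a, ha⟩ : ∃ a, T.card = a + 1 := ⟨T.card - 1, by omega⟩
    obtain ⟨b, hb⟩ : ∃ b, m = a + 1 + (b + 1) := ⟨m - T.card - 1, by omega⟩
    have : (T.card * w (T.card - 1) - ((m - T.card : ℕ) : ℝ) * w T.card) = 0 := by
      simp only [w, ha]
      have e1 : m - (a + 1 - 1) - 1 = b + 1 := by omega
      have e2 : m - (a + 1) - 1 = b := by omega
      have e3 : m - (a + 1) = b + 1 := by omega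
      rw [e1, e2, e3, Nat.add_sub_cancel, Nat.factorial_succ b, Nat.factorial_succ a]
      push_cast
      ring
    rw [this, zero_mul]
  · simp

lemma shap_perm {ι : Type*} [Fintype ι] [DecidableEq ι] (σ : Equiv.Perm ι)
    (η : Finset ι → ℝ) (h : ∀ S : Finset ι, η (S.map σ.toEmbedding) = η S) (i : ι) :
    conceptSHAP η i = conceptSHAP η (σ i) := by
  unfold conceptSHAP
  refine Finset.sum_bij (fun S _ => S.map σ.toEmbedding) ?_ ?_ ?_ ?_
  · intro S hS
    simp only [Finset.mem_powerset, Finset.subset_erase] at hS ⊢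
    simpa using hS.2
  · intro S _ T _ hST
    exact Finset.map_injective _ hST
  · intro S hS
    refine ⟨S.map σ.symm.toEmbedding, ?_, ?_⟩
    · simp only [Finset.mem_powerset, Finset.subset_erase] at hS ⊢
      simpa [Equiv.symm_apply_eq] using hS.2
    · ext x
      simp
  · intro S hS
    have e : insert (σ i) (S.map σ.toEmbedding) = (insert i S).map σ.toEmbedding := by
      simp [Finset.map_insert]
    rw [e, h, h, Finset.card_map]

/-- Unanimity game. -/
def unanimity {ι : Type*} [DecidableEq ι] (T : Finset ι) : Finset ι → ℝ :=
  fun S => if T ⊆ S then 1 else 0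

lemma value_unanimity {ι : Type*} [Fintype ι] [DecidableEq ι] (T : Finset ι) (hT : T.Nonempty)
    (v : ι → ℝ) (heff : ∑ i, v i = 1) (hsym : ∀ i ∈ T, ∀ j ∈ T, v i = v j)
    (hd : ∀ i, i ∉ T → v i = 0) (i : ι) : v i = if i ∈ T then (T.card : ℝ)⁻¹ else 0 := by
  split_ifs with hi
  · have : ∑ j, v j = ∑ j ∈ T, v j :=
      (Finset.sum_subset (Finset.subset_univ T) fun j _ hj => hd j hj).symm
    rw [this, Finset.sum_congr rfl fun j hj => hsym j hj i hi, Finset.sum_const,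
      nsmul_eq_mul] at heff
    exact eq_inv_of_mul_eq_one_right heff
  · exact hd i hi

lemma unanimity_empty {ι : Type*} [DecidableEq ι] (T : Finset ι) (hT : T.Nonempty) :
    unanimity T ∅ = 0 := by
  simp [unanimity, hT.ne_empty]

lemma unanimity_dummy {ι : Type*} [DecidableEq ι] (T : Finset ι) (i : ι) (hi : i ∉ T)
    (S : Finset ι) : unanimity T (insert i S) = unanimity T S := by
  simp [unanimity, Finset.subset_insert_iff_of_notMem hi]

/-- Uniqueness of ConceptSHAP: any assignment `ψ` of importance values to games
vanishing on `∅` that satisfies Efficiency, Symmetry, Dummy and Additivity must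
coincide with ConceptSHAP on all such games. -/
theorem conceptSHAP_unique {ι : Type*} [Fintype ι] [DecidableEq ι] [Nonempty ι]
    (ψ : (Finset ι → ℝ) → ι → ℝ)
    (heff : ∀ η : Finset ι → ℝ, η ∅ = 0 → ∑ i, ψ η i = η Finset.univ)
    (hsym : ∀ η : Finset ι → ℝ, η ∅ = 0 → ∀ i j : ι,
      (∀ S ⊆ Finset.univ \ {i, j}, η (insert i S) = η (insert j S)) → ψ η i = ψ η j)
    (hdummy : ∀ η : Finset ι → ℝ, η ∅ = 0 → ∀ i : ι,
      (∀ S ⊆ Finset.univ.erase i, η (insert i S) = η S) → ψ η i = 0)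
    (hadd : ∀ η η' : Finset ι → ℝ, η ∅ = 0 → η' ∅ = 0 → ∀ a₁ a₂ : ℝ, ∀ i : ι,
      ψ (fun S => a₁ * η S + a₂ * η' S) i = a₁ * ψ η i + a₂ * ψ η' i) :
    ∀ η : Finset ι → ℝ, η ∅ = 0 → ∀ i : ι, ψ η i = conceptSHAP η i := by
  classical
  have shap_add : ∀ (η η' : Finset ι → ℝ) (a₁ a₂ : ℝ) (i : ι),
      conceptSHAP (fun S => a₁ * η S + a₂ * η' S) i =
        a₁ * conceptSHAP η i + a₂ * conceptSHAP η' i := by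
    intro η η' a₁ a₂ i
    unfold conceptSHAP
    rw [Finset.mul_sum, Finset.mul_sum, ← Finset.sum_add_distrib]
    refine Finset.sum_congr rfl fun S _ => ?_
    ring
  have hu : ∀ T : Finset ι, T.Nonempty → ∀ i, ψ (unanimity T) i = conceptSHAP (unanimity T) i := by
    intro T hT i
    have h0 := unanimity_empty T hT
    have h1 : unanimity T Finset.univ = 1 := by simp [unanimity]
    rw [value_unanimity T hT (ψ (unanimity T)), value_unanimity T hT (conceptSHAP (unanimity T))]
    · rw [shap_eff _ h0, h1]
    · intro i hi j hj
      have := shap_perm (Equiv.swap i j) (unanimity T) ?_ i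
      · simpa using this
      intro S
      have hmap : T.map (Equiv.swap i j).toEmbedding = T := by
        apply Finset.eq_of_subset_of_card_le
        · intro x hx
          simp only [Finset.mem_map, Equiv.coe_toEmbedding] at hx
          obtain ⟨y, hy, rfl⟩ := hx
          rw [Equiv.swap_apply_def]
          split_ifs <;> assumption
        · simp
      have : T ⊆ S.map (Equiv.swap i j).toEmbedding ↔ T ⊆ S := by
        conv_lhs => rw [← hmap]
        exact Finset.map_subset_map
      simp [unanimity, this]
    · intro i hi
      unfold conceptSHAP
      refine Finset.sum_eq_zero fun S _ => ?_
      rw [unanimity_dummy T i hi, sub_self, mul_zero]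
    · rw [heff _ h0, h1]
    · intro i hi j hj
      refine hsym _ h0 i j fun S hS => ?_
      by_cases hij : i = j
      · rw [hij]
      have a : ¬ T ⊆ insert i S := fun h => by
        have := h hj
        rw [Finset.mem_insert] at this
        rcases this with h | h
        · exact hij h.symm
        · simpa using hS h
      have b : ¬ T ⊆ insert j S := fun h => by
        have := h hi
        rw [Finset.mem_insert] at this
        rcases this with h | h
        · exact hij h
        · simpa using hS h
      simp [unanimity, a, b]
    · intro i hi
      exact hdummy _ h0 i fun S _ => unanimity_dummy T i hi S
  let D : Submodule ℝ (Finset ι → ℝ) :=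
    { carrier := {η | η ∅ = 0 ∧ ∀ i, ψ η i = conceptSHAP η i}
      zero_mem' := by
        refine ⟨rfl, fun i => ?_⟩
        rw [hdummy 0 rfl i fun S _ => rfl]
        simp [conceptSHAP]
      add_mem' := by
        rintro a b ⟨ha, ha'⟩ ⟨hb, hb'⟩
        refine ⟨by simp [ha, hb], fun i => ?_⟩
        have e : a + b = fun S => 1 * a S + 1 * b S := by
          funext S
          simp
        rw [e, hadd a b ha hb, shap_add, ha', hb']
      smul_mem' := by
        rintro c a ⟨ha, ha'⟩
        refine ⟨by simp [ha], fun i => ?_⟩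
        have e : c • a = fun S => c * a S + 0 * a S := by
          funext S
          simp
        rw [e, hadd a a ha ha, shap_add, ha'] }
  have hsingle : ∀ T : Finset ι, T.Nonempty → (Pi.single T (1 : ℝ) : Finset ι → ℝ) ∈ D := by
    intro T
    induction T using WellFoundedGT.induction with
    | ind T ih =>
      intro hT
      have e : (Pi.single T (1 : ℝ) : Finset ι → ℝ) = unanimity T -
          ∑ S ∈ Finset.univ.filter (fun S => T < S), Pi.single S (1 : ℝ) := by
        funext R
        rw [Pi.sub_apply, Finset.sum_apply]
        simp only [Pi.single_apply, Finset.sum_ite_eq, Finset.mem_filter, Finset.mem_univ,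
          true_and, unanimity]
        by_cases h : R = T
        · subst h
          simp
        · by_cases h2 : T ⊆ R
          · have : T < R := lt_of_le_of_ne h2 (Ne.symm h)
            simp [h, h2, this]
          · have : ¬ T < R := fun h3 => h2 h3.le
            simp [h, h2, this]
      rw [e]
      refine D.sub_mem ⟨unanimity_empty T hT, hu T hT⟩ (D.sum_mem fun S hS => ?_)
      have hS' : T < S := by simpa using hS
      exact ih S hS' (hT.mono hS'.le)
  intro η h0
  have hmem : η ∈ D := by
    have e : η = ∑ T : Finset ι, η T • (Pi.single T (1 : ℝ) : Finset ι → ℝ) := by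
      funext R
      rw [Finset.sum_apply]
      simp [Pi.single_apply]
    rw [e]
    refine D.sum_mem fun T _ => ?_
    rcases T.eq_empty_or_nonempty with rfl | hT
    · rw [h0, zero_smul]
      exact D.zero_mem
    · exact D.smul_mem _ (hsingle T hT)
  exact hmem.2
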